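/- Let F ⊆ ([n] choose k) be an intersecting family with τ(F) = 3, n = 2k+1, k ≥ 5, and suppose the 3-element covers of F have no common element. Then |F| < |G(n,k)| = C(n−1, k−1) − 3k + 4. -/

import Mathlib

open Finset
open scoped FinsetFamily

/-- Double counting of the pairs `(A, A \ {x})` inside a ground set `X`, where only the members of
the shadow that satisfy `p` are counted. -/
theorem card_mul_le_card_filter_shadow_mul {α : Type*} [DecidableEq α]
    {𝒜 : Finset (Finset α)} {X : Finset α} {r m : ℕ} (p : Finset α → Prop) [DecidablePred p]
    (h𝒜 : ∀ A ∈ 𝒜, A ⊆ X ∧ #A = r + 1)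
    (hm : ∀ A ∈ 𝒜, m ≤ #{x ∈ A | p (A.erase x)}) :
    #𝒜 * m ≤ #{B ∈ ∂ 𝒜 | p B} * (#X - r) := by
  classical
  refine card_mul_le_card_mul (fun A B => B ⊆ A) (fun A hA => ?_) (fun B hB => ?_)
  · refine (hm A hA).trans ?_
    refine card_le_card_of_injOn (fun x => A.erase x) (fun x hx => ?_) (fun x hx y hy hxy => ?_)
    · simp only [coe_filter, Set.mem_ofPred_eq] at hx
      simp only [bipartiteAbove, coe_filter, Set.mem_ofPred_eq, mem_filter]
      exact ⟨⟨erase_mem_shadow hA hx.1, hx.2⟩, erase_subset _ _⟩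
    · simp only [coe_filter, Set.mem_ofPred_eq] at hx hy
      exact (erase_injOn A) hx.1 hy.1 hxy
  · obtain ⟨A₀, hA₀, hBA₀, hcard⟩ :=
      mem_shadow_iff_exists_mem_card_add_one.1 (mem_filter.1 hB).1
    have hBX : B ⊆ X := hBA₀.trans (h𝒜 A₀ hA₀).1
    have hBr : #B = r := by have := (h𝒜 A₀ hA₀).2; omega
    have hsub : bipartiteBelow (fun A B : Finset α => B ⊆ A) 𝒜 B ⊆
        (X \ B).image (fun x => insert x B) := by
      intro A hA
      simp only [bipartiteBelow, mem_filter] at hA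
      have hone : #(A \ B) = 1 := by
        have := card_sdiff_of_subset hA.2
        have := (h𝒜 A hA.1).2
        omega
      obtain ⟨x, hx⟩ := card_eq_one.1 hone
      have hxA : x ∈ A \ B := by simp [hx]
      rw [mem_sdiff] at hxA
      refine mem_image.2 ⟨x, mem_sdiff.2 ⟨(h𝒜 A hA.1).1 hxA.1, hxA.2⟩, ?_⟩
      rw [← sdiff_union_of_subset hA.2, hx]
      rfl
    calc _ ≤ #((X \ B).image (fun x => insert x B)) := card_le_card hsub
      _ ≤ #(X \ B) := card_image_le
      _ = #X - r := by rw [card_sdiff_of_subset hBX, hBr]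

/-- Every cardinality up to `n.choose r` is attained by an initial segment of the colex order. -/
theorem exists_isInitSeg_card_eq {n r m : ℕ} (hm : m ≤ n.choose r) :
    ∃ 𝒞 : Finset (Finset (Fin n)), Colex.IsInitSeg 𝒞 r ∧ #𝒞 = m := by
  induction m with
  | zero => exact ⟨∅, by simp, rfl⟩
  | succ m ih =>
    obtain ⟨𝒞, h𝒞, hcard⟩ := ih (by omega)
    have hne : (powersetCard r (univ : Finset (Fin n)) \ 𝒞).Nonempty := by
      rw [← card_pos]
      have := le_card_sdiff 𝒞 (powersetCard r (univ : Finset (Fin n)))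
      rw [card_powersetCard, card_univ, Fintype.card_fin] at this
      omega
    obtain ⟨s, hs, hmin⟩ := exists_min_image _ toColex hne
    simp only [mem_sdiff, mem_powersetCard, subset_univ, true_and] at hs hmin
    refine ⟨insert s 𝒞, ⟨?_, ?_⟩, by rw [card_insert_of_notMem hs.2, hcard]⟩
    · intro t ht
      rw [mem_coe, mem_insert] at ht
      rcases ht with rfl | ht
      · exact hs.1
      · exact h𝒞.1 ht
    · rintro u t hu ⟨htu, ht⟩
      by_cases htc : t ∈ 𝒞
      · exact mem_insert_of_mem htc
      · rcases mem_insert.1 hu with rfl | hu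
        · exact absurd htu (hmin t ⟨ht, htc⟩).not_gt
        · exact absurd (h𝒞.2 hu ⟨htu, ht⟩) htc

theorem toColex_lt_of_last_mem {n : ℕ} {s t : Finset (Fin (n + 1))} (hs : Fin.last n ∈ s)
    (ht : Fin.last n ∉ t) : toColex t < toColex s := by
  rw [Colex.toColex_lt_toColex_iff_exists_forall_lt]
  exact ⟨_, hs, ht, fun b hb hbs => Fin.lt_last_iff_ne_last.2 (by rintro rfl; exact ht hb)⟩

theorem initSeg_card_le_card_shadow {s p : ℕ} {𝒞 : Finset (Finset (Fin (2 * s + 2)))}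
    (h𝒞 : Colex.IsInitSeg 𝒞 (s + 1)) (hp : p ≤ (2 * s).choose s)
    (hcard : #𝒞 ≤ (2 * s + 1).choose (s + 1) + p) :
    (s + 1) * #𝒞 ≤ (s + 1) * #(∂ 𝒞) + p := by
  set top : Fin (2 * s + 2) := Fin.last _ with htop
  by_cases hC : ∃ c ∈ 𝒞, top ∈ c
  · obtain ⟨c, hc, htc⟩ := hC
    let pre : Fin (2 * s + 2) := ⟨2 * s, by omega⟩
    have hpt : pre ≠ top := by simp [pre, htop, Fin.ext_iff]
    have hlow : ∀ t : Finset (Fin (2 * s + 2)), #t = s + 1 → top ∉ t → t ∈ 𝒞 :=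
      fun t ht htt => h𝒞.2 hc ⟨toColex_lt_of_last_mem htc htt, ht⟩
    have hXcard : #((univ : Finset (Fin (2 * s + 2))).erase top) = 2 * s + 1 := by simp
    have hX'card : #(((univ : Finset (Fin (2 * s + 2))).erase top).erase pre) = 2 * s := by
      rw [card_erase_of_mem (by simp [hpt]), hXcard]; rfl
    have h0 : {t ∈ 𝒞 | top ∉ t} = powersetCard (s + 1) (univ.erase top) := by
      ext t
      simp only [mem_filter, mem_powersetCard, subset_erase, subset_univ, true_and]
      exact ⟨fun h => ⟨h.2, h𝒞.1 h.1⟩, fun h => ⟨hlow t h.2 h.1, h.1⟩⟩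
    have hsplit := card_filter_add_card_filter_not (s := 𝒞) (fun t => top ∈ t)
    rw [h0, card_powersetCard, hXcard] at hsplit
    have hnopre : ∀ t ∈ 𝒞, top ∈ t → pre ∉ t := by
      intro t ht htt hpre
      have hsub : insert t ((powersetCard s ((univ.erase top).erase pre)).image (insert top)) ⊆
          {t ∈ 𝒞 | top ∈ t} := by
        intro u hu
        rcases mem_insert.1 hu with rfl | hu
        · exact mem_filter.2 ⟨ht, htt⟩
        · obtain ⟨v, hv, rfl⟩ := mem_image.1 hu
          simp only [mem_powersetCard, subset_erase, subset_univ, true_and] at hv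
          refine mem_filter.2 ⟨h𝒞.2 ht ⟨?_, ?_⟩, mem_insert_self _ _⟩
          · rw [Colex.toColex_lt_toColex_iff_exists_forall_lt]
            refine ⟨pre, hpre, by simp [hpt, hv.1.2], fun b hb hbt => ?_⟩
            have hbtop : b ≠ top := by rintro rfl; exact hbt htt
            have hbpre : b ≠ pre := by rintro rfl; exact hbt hpre
            have := b.2
            simp only [ne_eq, Fin.ext_iff, htop, Fin.val_last, pre] at hbtop hbpre
            show b.1 < 2 * s
            omega
          · rw [card_insert_of_notMem hv.1.1, hv.2]
      have hnot : t ∉ (powersetCard s ((univ.erase top).erase pre)).image (insert top) := by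
        intro hmem
        obtain ⟨v, hv, rfl⟩ := mem_image.1 hmem
        simp only [mem_powersetCard, subset_erase, subset_univ, true_and] at hv
        rcases mem_insert.1 hpre with h | h
        · exact hpt h
        · exact hv.1.2 h
      have hle := card_le_card hsub
      rw [card_insert_of_notMem hnot, card_image_of_injOn, card_powersetCard, hX'card] at hle
      · omega
      · intro v hv w hw hvw
        simp only [mem_coe, mem_powersetCard, subset_erase,
          subset_univ, true_and] at hv hw
        rw [← erase_insert hv.1.1, ← erase_insert hw.1.1]
        exact congrArg (fun z => z.erase top) hvw
    have hup := card_mul_le_card_filter_shadow_mul (𝒜 := {t ∈ 𝒞 | top ∈ t})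
      (X := univ.erase pre) (r := s) (m := s) (fun B => top ∈ B)
      (fun A hA => by
        rw [mem_filter] at hA
        exact ⟨subset_erase.2 ⟨subset_univ _, hnopre A hA.1 hA.2⟩, h𝒞.1 hA.1⟩)
      (fun A hA => by
        rw [mem_filter] at hA
        have : A.erase top ⊆ {x ∈ A | top ∈ A.erase x} := by
          intro x hx
          rw [mem_erase] at hx
          exact mem_filter.2 ⟨hx.2, mem_erase.2 ⟨hx.1.symm, hA.2⟩⟩
        refine le_trans ?_ (card_le_card this)
        rw [card_erase_of_mem hA.2, h𝒞.1 hA.1]; rfl)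
    rw [card_erase_of_mem (mem_univ _), card_univ, Fintype.card_fin,
      show 2 * s + 2 - 1 - s = s + 1 by omega] at hup
    have hupsub : {B ∈ ∂ {t ∈ 𝒞 | top ∈ t} | top ∈ B} ⊆ {B ∈ ∂ 𝒞 | top ∈ B} :=
      filter_subset_filter _ (shadow_mono (filter_subset _ _))
    have hup' := card_le_card hupsub
    have hdown : powersetCard s (univ.erase top) ⊆ {B ∈ ∂ 𝒞 | top ∉ B} := by
      intro B hB
      simp only [mem_powersetCard, subset_erase, subset_univ, true_and] at hB
      refine mem_filter.2 ⟨mem_shadow_iff_insert_mem.2 ?_, hB.1⟩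
      by_cases hs0 : ∃ a, a ∉ B ∧ a ≠ top
      · obtain ⟨a, haB, hat⟩ := hs0
        refine ⟨a, haB, hlow _ (by rw [card_insert_of_notMem haB, hB.2]) ?_⟩
        simp [hB.1, hat.symm]
      · push Not at hs0
        have : univ.erase top ⊆ B := by
          intro a ha
          by_contra haB
          exact (mem_erase.1 ha).1 (hs0 a haB)
        have := card_le_card this
        omega
    have hdown' := card_le_card hdown
    rw [card_powersetCard, hXcard] at hdown'
    have hshsplit := card_filter_add_card_filter_not (s := ∂ 𝒞) (fun t => top ∈ t)
    have hsymm : (2 * s + 1).choose s = (2 * s + 1).choose (s + 1) :=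
      (Nat.choose_symm_half s).symm
    nlinarith
  · push Not at hC
    have := card_mul_le_card_filter_shadow_mul (𝒜 := 𝒞) (X := univ.erase top) (r := s)
      (m := s + 1) (fun _ => True)
      (fun A hA => ⟨subset_erase.2 ⟨subset_univ _, hC A hA⟩, h𝒞.1 hA⟩)
      (fun A hA => by simp [h𝒞.1 hA])
    rw [card_erase_of_mem (mem_univ _), card_univ, Fintype.card_fin,
      show 2 * s + 2 - 1 - s = s + 1 by omega, filter_true_of_mem (by simp)] at this
    nlinarith

/-- A lower bound for the shadow of a family of `(s + 1)`-subsets of a `(2 * s + 2)`-set that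
exceeds half of the middle layer by at most `p`. -/
theorem mul_card_le_mul_card_shadow_add {α : Type*} [DecidableEq α] {s p : ℕ} {Y : Finset α}
    (hY : #Y = 2 * s + 2) {𝒜 : Finset (Finset α)} (h𝒜 : ∀ A ∈ 𝒜, A ⊆ Y ∧ #A = s + 1)
    (hp : p ≤ (2 * s).choose s) (hcard : #𝒜 ≤ (2 * s + 1).choose (s + 1) + p) :
    (s + 1) * #𝒜 ≤ (s + 1) * #(∂ 𝒜) + p := by
  let e : Fin (2 * s + 2) ↪ α :=
    ((finCongr hY.symm).trans Y.equivFin.symm).toEmbedding.trans (Function.Embedding.subtype _)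
  have he : univ.map e = Y := by
    apply eq_of_subset_of_card_le
    · intro x hx
      obtain ⟨i, -, rfl⟩ := mem_map.1 hx
      simp [e]
    · rw [card_map, hY]; simp
  let pull : Finset α → Finset (Fin (2 * s + 2)) := fun A => {i | e i ∈ A}
  have hpull : ∀ A ⊆ Y, (pull A).map e = A := by
    intro A hA
    ext x
    simp only [pull, mem_map, mem_filter, mem_univ, true_and]
    constructor
    · rintro ⟨i, hi, rfl⟩; exact hi
    · intro hx
      have : x ∈ univ.map e := by rw [he]; exact hA hx
      obtain ⟨i, -, rfl⟩ := mem_map.1 this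
      exact ⟨i, hx, rfl⟩
  have hcardpull : #(𝒜.image pull) = #𝒜 := by
    refine card_image_of_injOn fun A hA B hB hAB => ?_
    rw [← hpull A (h𝒜 A hA).1, ← hpull B (h𝒜 B hB).1]
    exact congrArg _ hAB
  have hsized : ((𝒜.image pull : Finset _) : Set (Finset (Fin (2 * s + 2)))).Sized (s + 1) := by
    intro B hB
    obtain ⟨A, hA, rfl⟩ := mem_image.1 (mem_coe.1 hB)
    rw [← card_map e, hpull A (h𝒜 A hA).1, (h𝒜 A hA).2]
  have hshadow : #(∂ (𝒜.image pull)) ≤ #(∂ 𝒜) := by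
    refine card_le_card_of_injOn (fun B => B.map e) (fun B hB => ?_)
      (fun B _ C _ h => map_injective e h)
    obtain ⟨A', hA', i, hi, rfl⟩ := mem_shadow_iff.1 (mem_coe.1 hB)
    obtain ⟨A, hA, rfl⟩ := mem_image.1 hA'
    show ((pull A).erase i).map e ∈ ((∂ 𝒜 : Finset (Finset α)) : Set (Finset α))
    rw [map_erase, hpull A (h𝒜 A hA).1]
    exact erase_mem_shadow hA (by simpa [pull] using hi)
  have hle : #𝒜 ≤ (2 * s + 2).choose (s + 1) := by
    rw [← hcardpull]; simpa using hsized.card_le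
  obtain ⟨𝒞, h𝒞, h𝒞card⟩ := exists_isInitSeg_card_eq hle
  have hkk := kruskal_katona hsized (by rw [h𝒞card, hcardpull]) h𝒞
  have := initSeg_card_le_card_shadow h𝒞 hp (by omega)
  rw [h𝒞card] at this
  nlinarith

/-- An intersecting family of `(s + 2)`-sets covered by `T`, inside the disjoint union of `T` and a
set `Y` of size `2 * s + 2`. -/
structure IsCoveredFamily {α : Type*} [DecidableEq α] (F : Finset (Finset α)) (T Y : Finset α)
    (s : ℕ) : Prop where
  subset : ∀ A ∈ F, A ⊆ T ∪ Y
  card_eq : ∀ A ∈ F, #A = s + 2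
  inter : ∀ A ∈ F, ∀ B ∈ F, (A ∩ B).Nonempty
  cover : ∀ A ∈ F, (T ∩ A).Nonempty
  disjoint : Disjoint T Y
  card_ground : #Y = 2 * s + 2

/-- The members of `F` that meet `T` exactly in `S`. -/
def traceFiber {α : Type*} [DecidableEq α] (F : Finset (Finset α)) (T S : Finset α) :
    Finset (Finset α) :=
  {A ∈ F | A ∩ T = S}

/-- The complements in `Y` of the members of `F` that meet `T` exactly in `a`. -/
def coFiber {α : Type*} [DecidableEq α] (F : Finset (Finset α)) (T Y : Finset α) (a : α) :
    Finset (Finset α) :=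
  (traceFiber F T {a}).image (fun A => Y \ A)

namespace IsCoveredFamily

variable {α : Type*} [DecidableEq α] {F : Finset (Finset α)} {T Y S T' : Finset α} {s : ℕ}
  {a b c : α}

theorem trace_union (h : IsCoveredFamily F T Y s) {A : Finset α} (hA : A ∈ F) :
    A ∩ T ∪ A ∩ Y = A := by
  rw [← inter_union_distrib_left]
  exact inter_eq_left.2 (h.subset A hA)

theorem card_inter_ground (h : IsCoveredFamily F T Y s) {A : Finset α}
    (hA : A ∈ traceFiber F T S) : #(A ∩ Y) = s + 2 - #S := by
  rw [traceFiber, mem_filter] at hA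
  have hd : Disjoint (A ∩ T) (A ∩ Y) := h.disjoint.mono inter_subset_right inter_subset_right
  have := card_union_of_disjoint hd
  rw [h.trace_union hA.1, h.card_eq A hA.1, hA.2] at this
  omega

/-- The traces on `Y` of a fiber avoid any family of excluded sets. -/
theorem card_fiber_add_le (h : IsCoveredFamily F T Y s) {j : ℕ} (hj : s + 2 - #S = j)
    {𝒟 : Finset (Finset α)} (h𝒟 : 𝒟 ⊆ powersetCard j Y)
    (hav : ∀ A ∈ F, A ∩ T = S → A ∩ Y ∉ 𝒟) :
    #(traceFiber F T S) + #𝒟 ≤ (2 * s + 2).choose j := by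
  have hinj : Set.InjOn (fun A => A ∩ Y) (traceFiber F T S : Set (Finset α)) := by
    intro A hA B hB hAB
    have hA' := mem_filter.1 (mem_coe.1 hA)
    have hB' := mem_filter.1 (mem_coe.1 hB)
    rw [← h.trace_union hA'.1, ← h.trace_union hB'.1, hA'.2, hB'.2]
    exact congrArg _ hAB
  rw [← card_image_of_injOn hinj, ← card_union_of_disjoint, ← h.card_ground, ← card_powersetCard]
  · refine card_le_card (union_subset (fun B hB => ?_) h𝒟)
    obtain ⟨A, hA, rfl⟩ := mem_image.1 hB
    exact mem_powersetCard.2 ⟨inter_subset_right, by rw [h.card_inter_ground hA, hj]⟩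
  · rw [disjoint_left]
    intro B hB
    obtain ⟨A, hA, rfl⟩ := mem_image.1 hB
    exact hav A (mem_filter.1 hA).1 (mem_filter.1 hA).2

theorem false_of_subset_sdiff (h : IsCoveredFamily F T Y s) {A B : Finset α} (hA : A ∈ F)
    (hB : B ∈ F) (hT : Disjoint (A ∩ T) (B ∩ T)) (hY : A ∩ Y ⊆ Y \ B) : False := by
  obtain ⟨x, hx⟩ := h.inter A hA B hB
  rw [mem_inter] at hx
  rcases mem_union.1 (h.subset A hA hx.1) with hxT | hxY
  · exact disjoint_left.1 hT (mem_inter.2 ⟨hx.1, hxT⟩) (mem_inter.2 ⟨hx.2, hxT⟩)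
  · exact (mem_sdiff.1 (hY (mem_inter.2 ⟨hx.1, hxY⟩))).2 hx.2

theorem mem_coFiber (h : IsCoveredFamily F T Y s) :
    ∀ B ∈ coFiber F T Y a, B ⊆ Y ∧ #B = s + 1 := by
  intro B hB
  obtain ⟨A, hA, rfl⟩ := mem_image.1 hB
  refine ⟨sdiff_subset, ?_⟩
  have h1 := h.card_inter_ground hA
  have h2 := card_sdiff_add_card_inter Y A
  rw [inter_comm Y A, h1, h.card_ground, card_singleton] at h2
  omega

theorem card_coFiber (h : IsCoveredFamily F T Y s) :
    #(coFiber F T Y a) = #(traceFiber F T {a}) := by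
  refine card_image_of_injOn fun A hA B hB hAB => ?_
  have hA' := mem_filter.1 (mem_coe.1 hA)
  have hB' := mem_filter.1 (mem_coe.1 hB)
  rw [← h.trace_union hA'.1, ← h.trace_union hB'.1, hA'.2, hB'.2]
  have : Y \ (Y \ A) = Y \ (Y \ B) := congrArg _ hAB
  rw [sdiff_sdiff_right_self, sdiff_sdiff_right_self] at this
  rw [inter_comm A, inter_comm B]
  exact congrArg _ this

theorem card_fiber_add_card_fiber_le (h : IsCoveredFamily F T Y s) (hab : a ≠ b) :
    #(traceFiber F T {a}) + #(traceFiber F T {b}) ≤ (2 * s + 2).choose (s + 1) := by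
  rw [← h.card_coFiber (a := b)]
  refine h.card_fiber_add_le (by simp)
    (fun B hB => mem_powersetCard.2 (h.mem_coFiber B hB)) (fun A hA hAT hmem => ?_)
  obtain ⟨B, hB, hBA⟩ := mem_image.1 hmem
  have hB' := mem_filter.1 hB
  exact h.false_of_subset_sdiff hA hB'.1 (by simpa [hAT, hB'.2] using hab) hBA.ge

theorem shadow_coFiber_subset (h : IsCoveredFamily F T Y s) :
    ∂ (coFiber F T Y a) ⊆ powersetCard s Y := by
  intro B hB
  obtain ⟨A, hA, hBA, hcard⟩ := mem_shadow_iff_exists_mem_card_add_one.1 hB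
  have := h.mem_coFiber A hA
  exact mem_powersetCard.2 ⟨hBA.trans this.1, by omega⟩

/-- The traces of the members of `F` meeting `T` in a pair avoid the shadow of the opposite
`coFiber`, and any further excluded family. -/
theorem card_fiber_pair_add_le (h : IsCoveredFamily F T Y s) (hbc : b ≠ c) (hab : a ≠ b)
    (hac : a ≠ c) {W : Finset (Finset α)} (hW : W ⊆ powersetCard s Y)
    (hav : ∀ A ∈ F, A ∩ T = {b, c} → A ∩ Y ∉ W) :
    #(traceFiber F T {b, c}) + #(∂ (coFiber F T Y a) ∪ W) ≤ (2 * s + 2).choose s := by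
  refine h.card_fiber_add_le (by rw [card_pair hbc]; rfl)
    (union_subset h.shadow_coFiber_subset hW) (fun A hA hAT hmem => ?_)
  rcases mem_union.1 hmem with hmem | hmem
  · obtain ⟨C, hC, hAC⟩ := exists_subset_of_mem_shadow hmem
    obtain ⟨B, hB, rfl⟩ := mem_image.1 hC
    have hB' := mem_filter.1 hB
    refine h.false_of_subset_sdiff hA hB'.1 ?_ hAC
    simp [hAT, hB'.2, hab, hac]
  · exact hav A hA hAT hmem

/-- A second cover `T'` excludes, among the members of `F` whose trace on `T` misses `T'`, the
subsets of `Y \ T'`. -/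
theorem inter_notMem_powersetCard (h : IsCoveredFamily F T Y s)
    (hT' : ∀ A ∈ F, (T' ∩ A).Nonempty) (hS : Disjoint S T') {j : ℕ} :
    ∀ A ∈ F, A ∩ T = S → A ∩ Y ∉ powersetCard j (Y \ T') := by
  intro A hA hAT hmem
  obtain ⟨x, hx⟩ := hT' A hA
  rw [mem_inter] at hx
  have hsub := (mem_powersetCard.1 hmem).1
  rcases mem_union.1 (h.subset A hA hx.2) with hxT | hxY
  · exact disjoint_left.1 hS (hAT ▸ mem_inter.2 ⟨hx.2, hxT⟩) hx.1
  · exact (mem_sdiff.1 (hsub (mem_inter.2 ⟨hx.2, hxY⟩))).2 hx.1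

theorem card_le_sum (h : IsCoveredFamily F T Y s) (hT : T = {a, b, c}) :
    #F ≤ #(traceFiber F T {a}) + #(traceFiber F T {b}) + #(traceFiber F T {c})
      + #(traceFiber F T {a, b}) + #(traceFiber F T {a, c}) + #(traceFiber F T {b, c})
      + #(traceFiber F T {a, b, c}) := by
  have hsub : F ⊆ traceFiber F T {a} ∪ traceFiber F T {b} ∪ traceFiber F T {c}
      ∪ traceFiber F T {a, b} ∪ traceFiber F T {a, c} ∪ traceFiber F T {b, c}
      ∪ traceFiber F T {a, b, c} := by
    intro A hA
    have hne := h.cover A hA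
    simp only [traceFiber, mem_union, mem_filter, hA, true_and]
    subst hT
    by_cases ha : a ∈ A <;> by_cases hb : b ∈ A <;> by_cases hc : c ∈ A <;>
      simp_all [inter_insert_of_mem, inter_insert_of_notMem, insert_inter_of_mem,
        insert_inter_of_notMem]
  refine (card_le_card hsub).trans ?_
  refine (card_union_le _ _).trans (add_le_add_left ?_ _)
  refine (card_union_le _ _).trans (add_le_add_left ?_ _)
  refine (card_union_le _ _).trans (add_le_add_left ?_ _)
  refine (card_union_le _ _).trans (add_le_add_left ?_ _)
  refine (card_union_le _ _).trans (add_le_add_left ?_ _)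
  exact card_union_le _ _

theorem card_shadow_coFiber_ge (h : IsCoveredFamily F T Y s)
    (ha : #(traceFiber F T {a}) ≤ (2 * s + 1).choose (s + 1)) :
    #(traceFiber F T {a}) ≤ #(∂ (coFiber F T Y a)) := by
  have := mul_card_le_mul_card_shadow_add h.card_ground (h.mem_coFiber (a := a)) (p := 0)
    (Nat.zero_le _) (by rw [h.card_coFiber]; simpa using ha)
  rw [h.card_coFiber] at this
  exact Nat.le_of_mul_le_mul_left (by simpa using this) (Nat.succ_pos s)

end IsCoveredFamily

theorem catalan_succ_eq (n : ℕ) : (n + 2) * catalan (n + 1) = 2 * (2 * n + 1) * catalan n := by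
  have h3 := Nat.succ_mul_centralBinom_succ n
  rw [← succ_mul_catalan_eq_centralBinom n, ← succ_mul_catalan_eq_centralBinom (n + 1)] at h3
  apply Nat.eq_of_mul_eq_mul_left (Nat.succ_pos n)
  linarith

theorem three_mul_add_two_le_catalan {n : ℕ} (hn : 4 ≤ n) : 3 * n + 2 ≤ catalan n := by
  induction n, hn using Nat.le_induction with
  | base => rw [catalan_eq_centralBinom_div]; decide
  | succ n hn ih =>
    have h := catalan_succ_eq n
    by_contra! hlt
    nlinarith

theorem middle_choose_eq (s : ℕ) :
    (2 * s + 2).choose (s + 1) = (2 * s + 2).choose s + catalan (s + 1) := by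
  have h1 := succ_mul_catalan_eq_centralBinom (s + 1)
  rw [Nat.centralBinom, show 2 * (s + 1) = 2 * s + 2 by ring] at h1
  have h2 := Nat.choose_succ_right_eq (2 * s + 2) s
  rw [show 2 * s + 2 - s = s + 2 by omega, ← h1] at h2
  have h3 : (2 * s + 2).choose s = (s + 1) * catalan (s + 1) := by
    apply Nat.eq_of_mul_eq_mul_left (show 0 < s + 2 by omega)
    linarith
  rw [h3, ← h1]
  ring

theorem middle_choose_eq_two_mul (s : ℕ) :
    (2 * s + 2).choose (s + 1) = 2 * (2 * s + 1).choose (s + 1) := by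
  rw [Nat.choose_succ_succ (2 * s + 1) s, ← Nat.choose_symm_half s]
  ring

theorem choose_add_four_eq {s : ℕ} (hs : 1 ≤ s) : (2 * s + 4).choose (s + 1) =
    (2 * s + 2).choose (s + 1) + 2 * (2 * s + 2).choose s + (2 * s + 2).choose (s - 1) := by
  obtain ⟨u, rfl⟩ : ∃ u, s = u + 1 := ⟨s - 1, by omega⟩
  rw [Nat.choose_succ_succ (2 * (u + 1) + 3), Nat.choose_succ_succ (2 * (u + 1) + 2) u,
    Nat.choose_succ_succ (2 * (u + 1) + 2) (u + 1)]
  simp only [Nat.succ_eq_add_one, Nat.add_sub_cancel]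
  ring

namespace IsCoveredFamily

variable {α : Type*} [DecidableEq α] {F : Finset (Finset α)} {T Y T' : Finset α} {s : ℕ}
  {a b c : α}

theorem card_fiber_pair_add_shadow_le (h : IsCoveredFamily F T Y s) (hbc : b ≠ c) (hab : a ≠ b)
    (hac : a ≠ c) :
    #(traceFiber F T {b, c}) + #(∂ (coFiber F T Y a)) ≤ (2 * s + 2).choose s := by
  have := h.card_fiber_pair_add_le hbc hab hac (empty_subset _) (by simp)
  simpa using this

theorem card_fiber_triple_le (h : IsCoveredFamily F T Y s) (hab : a ≠ b) (hac : a ≠ c)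
    (hbc : b ≠ c) : #(traceFiber F T {a, b, c}) ≤ (2 * s + 2).choose (s - 1) := by
  have := h.card_fiber_add_le (S := {a, b, c}) (j := s - 1)
    (by rw [card_eq_three.2 ⟨a, b, c, hab, hac, hbc, rfl⟩]; omega) (empty_subset _) (by simp)
  simpa using this

/-- The bound when none of the three fibers over the points of `T` exceeds half of the middle
layer. -/
theorem card_add_le_of_forall_le (h : IsCoveredFamily F T Y s) (hs : 3 ≤ s) (hT : T = {a, b, c})
    (hab : a ≠ b) (hac : a ≠ c) (hbc : b ≠ c)
    (ha : #(traceFiber F T {a}) ≤ (2 * s + 1).choose (s + 1))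
    (hb : #(traceFiber F T {b}) ≤ (2 * s + 1).choose (s + 1))
    (hc : #(traceFiber F T {c}) ≤ (2 * s + 1).choose (s + 1)) :
    #F + 3 * (s + 1) ≤ (2 * s + 4).choose (s + 1) := by
  have h1 := h.card_le_sum hT
  have h2 := h.card_fiber_pair_add_shadow_le hbc hab hac
  have h3 := h.card_fiber_pair_add_shadow_le hac hab.symm hbc
  have h4 := h.card_fiber_pair_add_shadow_le hab hac.symm hbc.symm
  have h5 := h.card_fiber_triple_le hab hac hbc
  have h6 := h.card_shadow_coFiber_ge ha
  have h7 := h.card_shadow_coFiber_ge hb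
  have h8 := h.card_shadow_coFiber_ge hc
  have h9 := three_mul_add_two_le_catalan (n := s + 1) (by omega)
  have h10 := middle_choose_eq s
  have h11 := choose_add_four_eq (s := s) (by omega)
  omega

/-- The bound when the fiber over `a` is large and `T'` is a second cover disjoint from `T`. -/
theorem card_add_le_of_disjoint_cover (h : IsCoveredFamily F T Y s) (hs : 3 ≤ s)
    (hT : T = {a, b, c}) (hab : a ≠ b) (hac : a ≠ c) (hbc : b ≠ c)
    (ha : (2 * s + 1).choose (s + 1) < #(traceFiber F T {a}))
    (hT' : ∀ A ∈ F, (T' ∩ A).Nonempty) (hTT' : Disjoint T T') (hR : #(Y \ T') = 2 * s - 1) :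
    #F + 3 * (s + 1) ≤ (2 * s + 4).choose (s + 1) := by
  have hsub : ∀ j, powersetCard j (Y \ T') ⊆ powersetCard j Y :=
    fun j => powersetCard_mono sdiff_subset
  have hmid := middle_choose_eq_two_mul s
  have hpb := h.card_fiber_add_card_fiber_le hab
  have hpc := h.card_fiber_add_card_fiber_le hac
  have h1 := h.card_le_sum hT
  have h2 := h.card_fiber_pair_add_shadow_le hbc hab hac
  have h3 := h.card_fiber_pair_add_shadow_le hac hab.symm hbc
  have h4 := h.card_fiber_pair_add_shadow_le hab hac.symm hbc.symm
  have h4' := h.card_fiber_pair_add_le hab hac.symm hbc.symm (hsub s)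
    (h.inter_notMem_powersetCard hT' (hTT'.mono_left (by simp [hT, insert_subset_iff])))
  have h4'' := card_le_card (subset_union_right (s₁ := ∂ (coFiber F T Y c))
    (s₂ := powersetCard s (Y \ T')))
  have h5 := h.card_fiber_add_le (S := {a, b, c}) (j := s - 1)
    (by rw [card_eq_three.2 ⟨a, b, c, hab, hac, hbc, rfl⟩]; omega) (hsub _)
    (h.inter_notMem_powersetCard hT' (hTT'.mono_left hT.ge))
  have h6 := h.card_fiber_add_le (S := {a}) (j := s + 1) (by simp) (hsub _)
    (h.inter_notMem_powersetCard hT' (hTT'.mono_left (by simp [hT])))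
  have h7 := h.card_shadow_coFiber_ge (a := b) (by omega)
  have h8 := h.card_shadow_coFiber_ge (a := c) (by omega)
  have h9 := card_mul_le_card_filter_shadow_mul (fun _ => True) (h.mem_coFiber (a := a))
    (m := s + 1) (fun A hA => by simp [(h.mem_coFiber A hA).2])
  rw [h.card_coFiber, h.card_ground, filter_true_of_mem (by simp),
    show 2 * s + 2 - s = s + 2 by omega] at h9
  rw [card_powersetCard, hR] at h4'' h5 h6
  have h10 := choose_add_four_eq (s := s) (by omega)
  obtain rfl | hs' := hs.eq_or_lt
  · norm_num [Nat.choose] at *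
    omega
  have h11 := middle_choose_eq s
  have h12 := three_mul_add_two_le_catalan hs'
  have h13 := succ_mul_catalan_eq_centralBinom s
  have h14 : s.centralBinom = 2 * (2 * s - 1).choose (s - 1) := by
    obtain ⟨u, rfl⟩ : ∃ u, s = u + 1 := ⟨s - 1, by omega⟩
    rw [Nat.centralBinom, show 2 * (u + 1) = 2 * u + 2 by ring, middle_choose_eq_two_mul,
      Nat.choose_symm_half]
    rfl
  have h15 : 3 * (s + 1) ≤ (2 * s - 1).choose (s - 1) := by nlinarith
  have h16 := succ_mul_catalan_eq_centralBinom (s + 1)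
  rw [Nat.centralBinom, show 2 * (s + 1) = 2 * s + 2 by ring] at h16
  have h17 : #(traceFiber F T {a}) ≤ #(∂ (coFiber F T Y a)) + catalan (s + 1) := by
    by_contra! hlt
    nlinarith
  omega

/-- The bound when the fiber over `a` is large and `T'` is a second cover meeting `T` in `b`. -/
theorem card_add_le_of_cover_inter_singleton (h : IsCoveredFamily F T Y s) (hs : 3 ≤ s)
    (hT : T = {a, b, c}) (hab : a ≠ b) (hac : a ≠ c) (hbc : b ≠ c)
    (ha : (2 * s + 1).choose (s + 1) < #(traceFiber F T {a}))
    (hT' : ∀ A ∈ F, (T' ∩ A).Nonempty) (haT' : a ∉ T') (hcT' : c ∉ T')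
    (hR : #(Y \ T') = 2 * s) :
    #F + 3 * (s + 1) ≤ (2 * s + 4).choose (s + 1) := by
  have hsub : ∀ j, powersetCard j (Y \ T') ⊆ powersetCard j Y :=
    fun j => powersetCard_mono sdiff_subset
  have hmid := middle_choose_eq_two_mul s
  have hpascal := Nat.choose_succ_succ (2 * s) s
  simp only [Nat.succ_eq_add_one] at hpascal
  have hpb := h.card_fiber_add_card_fiber_le hab
  have hpc := h.card_fiber_add_card_fiber_le hac
  have h1 := h.card_le_sum hT
  have h2 := h.card_fiber_pair_add_shadow_le hbc hab hac
  have h3 := h.card_fiber_pair_add_shadow_le hac hab.symm hbc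
  have h4 := h.card_fiber_pair_add_shadow_le hab hac.symm hbc.symm
  have h5 := h.card_fiber_triple_le hab hac hbc
  have h6 := h.card_fiber_add_le (S := {a}) (j := s + 1) (by simp) (hsub _)
    (h.inter_notMem_powersetCard hT' (by simpa using haT'))
  rw [card_powersetCard, hR] at h6
  have h7 := h.card_shadow_coFiber_ge (a := b) (by omega)
  have h8 := h.card_shadow_coFiber_ge (a := c) (by omega)
  have h9 := mul_card_le_mul_card_shadow_add h.card_ground (h.mem_coFiber (a := a))
    (p := #(traceFiber F T {a}) - (2 * s + 1).choose (s + 1)) (by omega)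
    (by rw [h.card_coFiber]; omega)
  rw [h.card_coFiber] at h9
  have h10 := choose_add_four_eq (s := s) (by omega)
  obtain rfl | hs' := hs.eq_or_lt
  · have h3' := h.card_fiber_pair_add_le hac hab.symm hbc (hsub 3)
      (h.inter_notMem_powersetCard hT' (by simp [haT', hcT']))
    have hW : 20 + #{B ∈ ∂ (coFiber F T Y b) | ¬ Disjoint B T'} ≤
        #(∂ (coFiber F T Y b) ∪ powersetCard 3 (Y \ T')) := by
      have hcardW : #(powersetCard 3 (Y \ T')) = 20 := by rw [card_powersetCard, hR]; rfl
      rw [← hcardW, add_comm, ← card_union_of_disjoint]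
      · exact card_le_card (union_subset_union_left (filter_subset _ _))
      · rw [disjoint_left]
        intro B hB hB'
        exact (mem_filter.1 hB).2
          (sdiff_disjoint.mono_left (mem_powersetCard.1 hB').1)
    have hsplit := card_filter_add_card_filter_not (s := coFiber F T Y b) (fun B => Disjoint B T')
    have hp0 : #{B ∈ coFiber F T Y b | Disjoint B T'} ≤ 15 := by
      have : {B ∈ coFiber F T Y b | Disjoint B T'} ⊆ powersetCard 4 (Y \ T') := by
        intro B hB
        rw [mem_filter] at hB
        have := h.mem_coFiber B hB.1
        exact mem_powersetCard.2 ⟨subset_sdiff.2 ⟨this.1, hB.2⟩, this.2⟩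
      have := card_le_card this
      rw [card_powersetCard, hR] at this
      exact this
    have hp1 := card_mul_le_card_filter_shadow_mul
      (𝒜 := {B ∈ coFiber F T Y b | ¬ Disjoint B T'}) (X := Y) (r := 3) (m := 3)
      (fun B => ¬ Disjoint B T') (fun A hA => h.mem_coFiber A (mem_filter.1 hA).1)
      (fun A hA => by
        rw [mem_filter] at hA
        obtain ⟨x, hxA, hxT⟩ := not_disjoint_iff.1 hA.2
        have hss : A.erase x ⊆ {y ∈ A | ¬ Disjoint (A.erase y) T'} := by
          intro y hy
          rw [mem_erase] at hy
          exact mem_filter.2 ⟨hy.2, not_disjoint_iff.2 ⟨x, mem_erase.2 ⟨hy.1.symm, hxA⟩, hxT⟩⟩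
        refine le_trans ?_ (card_le_card hss)
        rw [card_erase_of_mem hxA, (h.mem_coFiber A hA.1).2])
    have hp1' : #{B ∈ ∂ {B ∈ coFiber F T Y b | ¬ Disjoint B T'} | ¬ Disjoint B T'} ≤
        #{B ∈ ∂ (coFiber F T Y b) | ¬ Disjoint B T'} :=
      card_le_card (filter_subset_filter _ (shadow_mono (filter_subset _ _)))
    rw [h.card_ground] at hp1
    rw [h.card_coFiber] at hsplit
    norm_num [Nat.choose] at *
    omega
  have h11 := middle_choose_eq s
  have h12 := three_mul_add_two_le_catalan hs'
  have h13 := succ_mul_catalan_eq_centralBinom s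
  rw [Nat.centralBinom] at h13
  have h14 := catalan_succ_eq s
  have h15 : 3 * catalan s ≤ catalan (s + 1) := by
    by_contra! hlt
    nlinarith
  have h16 : #(traceFiber F T {a}) ≤ #(∂ (coFiber F T Y a)) + catalan s := by
    have : #(traceFiber F T {a}) - (2 * s + 1).choose (s + 1) ≤ (2 * s).choose s := by omega
    refine Nat.le_of_mul_le_mul_left ?_ (show 0 < s + 1 by omega)
    rw [Nat.mul_add]
    omega
  omega

/-- The bound when the fiber over `a` is large and some `3`-cover avoids `a`. -/
theorem card_add_le_of_cover_notMem (h : IsCoveredFamily F T Y s) (hs : 3 ≤ s)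
    (hT : T = {a, b, c}) (hab : a ≠ b) (hac : a ≠ c) (hbc : b ≠ c)
    (ha : (2 * s + 1).choose (s + 1) < #(traceFiber F T {a}))
    (hT' : ∀ A ∈ F, (T' ∩ A).Nonempty) (hsubT' : T' ⊆ T ∪ Y) (hcT' : #T' = 3) (haT' : a ∉ T') :
    #F + 3 * (s + 1) ≤ (2 * s + 4).choose (s + 1) := by
  have hdisj : Disjoint (T' ∩ T) (T' ∩ Y) :=
    h.disjoint.mono inter_subset_right inter_subset_right
  have hcard := card_union_of_disjoint hdisj
  rw [← inter_union_distrib_left, inter_eq_left.2 hsubT', hcT'] at hcard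
  have hYT := card_sdiff_add_card_inter Y T'
  rw [inter_comm Y T', h.card_ground] at hYT
  by_cases hb : b ∈ T' <;> by_cases hc : c ∈ T'
  · have hTc : #(T' ∩ T) = 2 := by
      have : T' ∩ T = {b, c} := by
        subst hT; ext x; simp only [mem_inter, mem_insert, mem_singleton]; grind
      rw [this, card_pair hbc]
    have h6 := h.card_fiber_add_le (S := {a}) (j := s + 1) (by simp)
      (powersetCard_mono sdiff_subset)
      (h.inter_notMem_powersetCard hT' (by simpa using haT'))
    rw [card_powersetCard, show #(Y \ T') = 2 * s + 1 by omega] at h6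
    have := middle_choose_eq_two_mul s
    omega
  · have hTc : T' ∩ T = {b} := by
      subst hT; ext x; simp only [mem_inter, mem_insert, mem_singleton]; grind
    rw [hTc, card_singleton] at hcard
    exact h.card_add_le_of_cover_inter_singleton hs hT hab hac hbc ha hT' haT' hc (by omega)
  · have hTc : T' ∩ T = {c} := by
      subst hT; ext x; simp only [mem_inter, mem_insert, mem_singleton]; grind
    rw [hTc, card_singleton] at hcard
    exact h.card_add_le_of_cover_inter_singleton hs (hT.trans (by rw [pair_comm])) hac hab
      hbc.symm ha hT' haT' hb (by omega)
  · have hTc : T' ∩ T = ∅ := by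
      subst hT; ext x; simp only [mem_inter, mem_insert, mem_singleton]; grind
    rw [hTc, card_empty] at hcard
    exact h.card_add_le_of_disjoint_cover hs hT hab hac hbc ha hT'
      (disjoint_iff_inter_eq_empty.2 (by rw [inter_comm, hTc])) (by omega)

end IsCoveredFamily

/-- For an intersecting family `F ⊆ ([n] choose k)` with covering number `3`, `n = 2k+1`,
`k ≥ 5`, whose 3-element covers have no common element: `|F| < C(n-1,k-1) - 3k + 4`. -/
theorem case_n_eq_2k_plus_one
    (n k : ℕ) (hk : 5 ≤ k) (hn : n = 2 * k + 1)
    (F : Finset (Finset ℕ))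
    (hFsub : ∀ A ∈ F, A ⊆ Finset.Icc 1 n ∧ A.card = k)
    (hint : ∀ A ∈ F, ∀ A' ∈ F, (A ∩ A').Nonempty)
    -- τ(F) = 3
    (hτlow : ∀ S ⊆ Finset.Icc 1 n, S.card ≤ 2 → ∃ A ∈ F, S ∩ A = ∅)
    (hτup : ∃ S ⊆ Finset.Icc 1 n, S.card = 3 ∧ ∀ A ∈ F, (S ∩ A).Nonempty)
    -- the 3-element covers of F have no common element
    (hnontriv : ¬ ∃ x, ∀ S ⊆ Finset.Icc 1 n,
      S.card = 3 → (∀ A ∈ F, (S ∩ A).Nonempty) → x ∈ S) :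
    (F.card : ℤ) < ((n - 1).choose (k - 1) : ℤ) - 3 * k + 4 := by
  obtain ⟨T, hTn, hTcard, hTcov⟩ := hτup
  obtain ⟨s, rfl⟩ : ∃ s, k = s + 2 := ⟨k - 2, by omega⟩
  have hs : 3 ≤ s := by omega
  have h : IsCoveredFamily F T (Icc 1 n \ T) s :=
    { subset := fun A hA => by
        rw [union_sdiff_of_subset hTn]; exact (hFsub A hA).1
      card_eq := fun A hA => (hFsub A hA).2
      inter := hint
      cover := hTcov
      disjoint := disjoint_sdiff
      card_ground := by rw [card_sdiff_of_subset hTn, hTcard, Nat.card_Icc]; omega }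
  have hcov : ∀ x, ∃ T' ⊆ T ∪ (Icc 1 n \ T), #T' = 3 ∧ (∀ A ∈ F, (T' ∩ A).Nonempty) ∧ x ∉ T' := by
    rw [union_sdiff_of_subset hTn]
    push Not at hnontriv
    exact hnontriv
  obtain ⟨a, b, c, hab, hac, hbc, hT⟩ := card_eq_three.1 hTcard
  have key : #F + 3 * (s + 1) ≤ (2 * s + 4).choose (s + 1) := by
    by_cases ha : #(traceFiber F T {a}) ≤ (2 * s + 1).choose (s + 1)
    · by_cases hb : #(traceFiber F T {b}) ≤ (2 * s + 1).choose (s + 1)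
      · by_cases hc : #(traceFiber F T {c}) ≤ (2 * s + 1).choose (s + 1)
        · exact h.card_add_le_of_forall_le hs hT hab hac hbc ha hb hc
        · obtain ⟨T', hsub, h3, hT', hx⟩ := hcov c
          exact h.card_add_le_of_cover_notMem hs (hT.trans (by grind)) hac.symm hbc.symm hab
            (not_le.1 hc) hT' hsub h3 hx
      · obtain ⟨T', hsub, h3, hT', hx⟩ := hcov b
        exact h.card_add_le_of_cover_notMem hs (hT.trans (insert_comm _ _ _)) hab.symm hbc hac
          (not_le.1 hb) hT' hsub h3 hx
    · obtain ⟨T', hsub, h3, hT', hx⟩ := hcov a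
      exact h.card_add_le_of_cover_notMem hs hT hab hac hbc (not_le.1 ha) hT' hsub h3 hx
  have hchoose : (n - 1).choose (s + 2 - 1) = (2 * s + 4).choose (s + 1) := by
    congr 1
    omega
  rw [hchoose]
  push_cast
  omega
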